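/- Let (E, d) be a metric space, C : E → ℝ an L-Lipschitz function, 𝒞 ⊆ E a finite nonempty set of centers, and for each φ ∈ 𝒞 let Ĉ(φ) ∈ ℝ and rad_φ ≥ 0 satisfy |Ĉ(φ) − C(φ)| ≤ rad_φ. Fix θ ∈ 𝒞 and r > 0, and suppose the elimination certificate holds: Ĉ(θ) − rad_θ > min_{φ ∈ 𝒞} (Ĉ(φ) + rad_φ) + L·r. Then for every x ∈ E with d(x, θ) ≤ r, one has C(x) > min_{φ ∈ 𝒞} C(φ). In particular the entire ball B(θ, r) contains no minimizer of C over E. -/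

import Mathlib

/-- (Soundness of the noisy elimination certificate.)
If the elimination certificate `LCB(θ) > UCB* + L·r` holds at a center `θ` of a
finite net `𝒞`, where the noisy estimates are accurate to within their confidence
radii and `C` is `L`-Lipschitz, then every point of the ball `B(θ, r)` has cost
strictly above `min_{φ ∈ 𝒞} C(φ)`; in particular the ball contains no minimizer of
`C` over `E`. -/
theorem statement_9 {E : Type*} [MetricSpace E]
    (C : E → ℝ) (L : ℝ) (hL : 0 ≤ L)
    (hLip : ∀ x y, |C x - C y| ≤ L * dist x y)
    (𝒞 : Finset E) (hne : 𝒞.Nonempty)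
    (Chat rad : E → ℝ)
    (hradnn : ∀ φ ∈ 𝒞, 0 ≤ rad φ)
    (hacc : ∀ φ ∈ 𝒞, |Chat φ - C φ| ≤ rad φ)
    (θ : E) (hθ : θ ∈ 𝒞) (r : ℝ) (hr : 0 < r)
    (hEC : 𝒞.inf' hne (fun φ => Chat φ + rad φ) + L * r < Chat θ - rad θ) :
    ∀ x : E, dist x θ ≤ r →
      (𝒞.inf' hne C < C x ∧ ∀ xmin : E, (∀ y, C xmin ≤ C y) → x ≠ xmin) := by
  intro x hx
  have hmin : 𝒞.inf' hne C < C x := by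
    have hle : 𝒞.inf' hne C ≤ 𝒞.inf' hne (fun φ => Chat φ + rad φ) :=
      Finset.inf'_mono_fun fun φ hφ => by linarith [(abs_le.mp (hacc φ hφ)).1]
    have hdist : L * dist x θ ≤ L * r := mul_le_mul_of_nonneg_left hx hL
    linarith [(abs_le.mp (hLip x θ)).1, (abs_le.mp (hacc θ hθ)).2]
  refine ⟨hmin, ?_⟩
  rintro xmin hxmin rfl
  obtain ⟨φ, -, hφ⟩ := 𝒞.exists_mem_eq_inf' hne C
  linarith [hxmin φ]
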